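/- Orthogonality of the Tratnik polynomials of q-Racah type: for all nonnegative integers i, j, k, ℓ with i+j ≤ N and k+ℓ ≤ N, one has Σ_{x,y ≥ 0, x+y ≤ N} Ω(y;c₄,c₀,c₃;N−x)·Λ(x;c₁,c₂,c₃,c₄;N)·T_{i,j}(x,y;c₁,c₂,c₃,c₄;N)·T_{k,ℓ}(x,y;c₁,c₂,c₃,c₄;N) = δ_{i,k}·δ_{j,ℓ}·Ω(i;c₁,c₂,c₃;N−j)·Λ(j;c₄,c₀,c₃,c₁;N). -/

import Mathlib

noncomputable section
namespace qR

/-- q-Pochhammer symbol `(a;q)_k = ∏_{l<k} (1 - a qˡ)`. -/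
def poch (q a : ℂ) (k : ℕ) : ℂ := ∏ l ∈ Finset.range k, (1 - a * q ^ l)

/-- q-binomial coefficient, zero outside `0 ≤ n ≤ N`. -/
def binom (q : ℂ) (N n : ℤ) : ℂ :=
  if 0 ≤ n ∧ n ≤ N then poch q q N.toNat / (poch q q n.toNat * poch q q (N - n).toNat) else 0

/-- Normalisation `Ω(n;c1,c2,c3;N)`; `s` and `t2` are the chosen square roots of `q` and `c2`,
so that `(q c2)^(n - N/2) = (s t2)^(2n - N)`. -/
def Om (q s c1 c2 c3 t2 : ℂ) (N n : ℤ) : ℂ :=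
  binom q N n * (1 - c2 * c3 * q ^ (2 * n + 1)) * poch q (q * c2) n.toNat
      * poch q (c1 * c2 * c3 * q ^ (N + 2)) n.toNat * poch q (q * c1) (N - n).toNat
    / ((s * t2) ^ (2 * n - N) * poch q (c2 * c3 * q ^ (n + 1)) (N + 1).toNat
        * poch q (q * c3) n.toNat)

/-- Normalised q-Racah polynomial `p_n(x;c1,c2,c3;N)`, with the convention that it
vanishes unless `0 ≤ n ≤ N` and `0 ≤ x ≤ N`. -/
def p (q s c1 c2 c3 t2 : ℂ) (N n x : ℤ) : ℂ :=
  if 0 ≤ n ∧ n ≤ N ∧ 0 ≤ x ∧ x ≤ N then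
    Om q s c1 c2 c3 t2 N n *
      ∑ k ∈ Finset.range (n.toNat + 1),
        poch q (q ^ (-n)) k * poch q (c2 * c3 * q ^ (n + 1)) k * poch q (q ^ (-x)) k
            * poch q (c1 * c2 * q ^ (x + 1)) k * q ^ k
          / (poch q (q * c2) k * poch q (c1 * c2 * c3 * q ^ (N + 2)) k
              * poch q (q ^ (-N)) k * poch q q k)
  else 0

/-- `ω_n(c) = (-1)^n c^{n/2} q^{n(n+1)/2}`, where `r` is the chosen square root of `c`. -/
def om (q r : ℂ) (n : ℤ) : ℂ := (-1 : ℂ) ^ n * r ^ n * q ^ (n * (n + 1) / 2)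

/-- `ξ_n(c1,c2) = ((qc1;q)_n/(qc2;q)_n) (c2/c1)^{n/2}`, where `t1, t2` are the chosen
square roots of `c1, c2`. -/
def xi (q c1 c2 t1 t2 : ℂ) (n : ℤ) : ℂ :=
  poch q (q * c1) n.toNat / poch q (q * c2) n.toNat * (t2 / t1) ^ n

/-- `λ(x;c) = -(1-q^{-x})(1-c q^{x+1})`. -/
def lam (q c : ℂ) (x : ℤ) : ℂ := -(1 - q ^ (-x)) * (1 - c * q ^ (x + 1))

def PhiP (q c1 c2 c3 : ℂ) (N n : ℤ) : ℂ :=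
  -c2 * q ^ (n - N) * (1 - q ^ n) * (1 - c1 * q ^ (N - n + 1)) * (1 - c2 * c3 * q ^ (n + N + 1))
      * (1 - c3 * q ^ n)
    / ((1 - c2 * c3 * q ^ (2 * n)) * (1 - c2 * c3 * q ^ (2 * n + 1)))

def PhiM (q c1 c2 c3 : ℂ) (N n : ℤ) : ℂ :=
  (1 - q ^ (n - N)) * (1 - c1 * c2 * c3 * q ^ (n + N + 2)) * (1 - c2 * q ^ (n + 1))
      * (1 - c2 * c3 * q ^ (n + 1))
    / ((1 - c2 * c3 * q ^ (2 * n + 1)) * (1 - c2 * c3 * q ^ (2 * n + 2)))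

/-- `Φ^ε(n;c1,c2,c3;N)`, where `ε = 1, -1, 0` selects `Φ⁺, Φ⁻, Φ⁰`. -/
def Phi (q c1 c2 c3 : ℂ) (N ε n : ℤ) : ℂ :=
  if ε = 1 then PhiP q c1 c2 c3 N n
  else if ε = -1 then PhiM q c1 c2 c3 N n
  else -PhiP q c1 c2 c3 N n - PhiM q c1 c2 c3 N n

/-- `λ₊(x;c1,c2,c3;N)`. -/
def lamP (q c1 c2 c3 : ℂ) (N x : ℤ) : ℂ :=
  -(q ^ (-N - 1) / c3 - q ^ (-x)) * (1 - c1 * c2 * c3 * q ^ (N + x + 2))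

/-- `λ₋(x;c1,c2,c3;N)`. -/
def lamM (q c1 c2 c3 : ℂ) (N x : ℤ) : ℂ :=
  -(q ^ (-N) - q ^ (-x)) * (1 - c1 * c2 * q ^ (N + x + 1))

def PhiPp (q sq c1 c2 c3 : ℂ) (N n : ℤ) : ℂ :=
  -sq * c2 * q ^ (2 * n - N - 1) * (1 - q ^ n) * (1 - c1 * q ^ (N - n + 1))
      * (1 - c1 * q ^ (N + 2 - n)) * (1 - c3 * q ^ n)
    / ((1 - c2 * c3 * q ^ (2 * n)) * (1 - c2 * c3 * q ^ (2 * n + 1)))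

def PhiPm (q sq c1 c2 c3 : ℂ) (N n : ℤ) : ℂ :=
  -((1 - c1 * c2 * c3 * q ^ (n + N + 2)) * (1 - c1 * c2 * c3 * q ^ (n + N + 3))
      * (1 - c2 * q ^ (n + 1)) * (1 - c2 * c3 * q ^ (n + 1)))
    / (c3 * q ^ (N + 1) * sq * (1 - c2 * c3 * q ^ (2 * n + 1)) * (1 - c2 * c3 * q ^ (2 * n + 2)))

def PhiP0 (q sq c1 c2 c3 : ℂ) (N n : ℤ) : ℂ :=
  -PhiPp q sq c1 c2 c3 N n - PhiPm q sq c1 c2 c3 N n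
    - (1 - c1 * c2 * q ^ (N + 2)) * (1 - c1 * c2 * c3 * q ^ (N + 2)) / (c3 * q ^ (N + 1) * sq)

def PhiMp (q sq c1 c2 c3 : ℂ) (N n : ℤ) : ℂ :=
  -sq * (1 - q ^ n) * (1 - c3 * q ^ n) * (1 - c2 * c3 * q ^ (n + N))
      * (1 - c2 * c3 * q ^ (n + N + 1))
    / (q ^ N * (1 - c2 * c3 * q ^ (2 * n)) * (1 - c2 * c3 * q ^ (2 * n + 1)))

def PhiMm (q sq c1 c2 c3 : ℂ) (N n : ℤ) : ℂ :=
  -c3 * sq * q ^ N * (1 - q ^ (n - N)) * (1 - q ^ (n - N + 1)) * (1 - c2 * q ^ (n + 1))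
      * (1 - c2 * c3 * q ^ (n + 1))
    / ((1 - c2 * c3 * q ^ (2 * n + 1)) * (1 - c2 * c3 * q ^ (2 * n + 2)))

def PhiM0 (q sq c1 c2 c3 : ℂ) (N n : ℤ) : ℂ :=
  -PhiMp q sq c1 c2 c3 N n - PhiMm q sq c1 c2 c3 N n - sq * (1 - c3 * q ^ N) * (q ^ (-N) - 1)

/-- Contiguity coefficient `Φ_σ^ε(n;c1,c2,c3;N)`, where `σ = 1` is the `+` and `σ = -1`
the `-` family, `ε ∈ {1,0,-1}` selects the superscript, and `sq` is the chosen square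
root of `q c2`. -/
def PhiC (q sq c1 c2 c3 : ℂ) (σ ε N n : ℤ) : ℂ :=
  if σ = 1 then
    if ε = 1 then PhiPp q sq c1 c2 c3 N n
    else if ε = -1 then PhiPm q sq c1 c2 c3 N n
    else PhiP0 q sq c1 c2 c3 N n
  else
    if ε = 1 then PhiMp q sq c1 c2 c3 N n
    else if ε = -1 then PhiMm q sq c1 c2 c3 N n
    else PhiM0 q sq c1 c2 c3 N n

def Fp (q c1 c2 : ℂ) (x : ℤ) : ℂ :=
  c1 * c2 ^ 2 * q ^ (x + 1) * (1 - c1 * q ^ x) * (1 - q ^ x)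
    / ((1 - c1 * c2 * q ^ (2 * x)) * (1 - c1 * c2 * q ^ (2 * x + 1)))

def Fm (q c1 c2 : ℂ) (x : ℤ) : ℂ :=
  c1 * c2 * q ^ (x + 1) * (1 - c2 * q ^ (x + 1)) * (1 - c1 * c2 * q ^ (x + 1))
    / ((1 - c1 * c2 * q ^ (2 * x + 1)) * (1 - c1 * c2 * q ^ (2 * x + 2)))

/-- The coefficients `A^{ε,ε'}_{i,j}(c1,c2,c3,c4;N)` for `(ε,ε') ≠ (0,0)`;
`t2` is the chosen square root of `c2` and the fifth parameter
`c0 = (q^{2N+3} c1 c2 c3 c4)⁻¹` is computed internally. -/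
def Aaux (q s c1 c2 c3 c4 t2 : ℂ) (N ε ε' i j : ℤ) : ℂ :=
  if ε' = 1 ∨ ε' = -1 then
    -c3 * q ^ (N + 1) *
        (if ε' = 1 then Fp q c4 ((q ^ (2 * N + 3) * c1 * c2 * c3 * c4)⁻¹) j
         else Fm q c4 ((q ^ (2 * N + 3) * c1 * c2 * c3 * c4)⁻¹) j) *
        PhiC q (s * t2) c1 c2 c3 ε' ε (N - j) i
  else if ε = 1 ∨ ε = -1 then
    c3 * q ^ (N + 1) *
        (Fp q c4 ((q ^ (2 * N + 3) * c1 * c2 * c3 * c4)⁻¹) j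
          + Fm q c4 ((q ^ (2 * N + 3) * c1 * c2 * c3 * c4)⁻¹) j) *
        Phi q c1 c2 c3 (N - j) ε i
  else 0

/-- The coefficients `A^{ε,ε'}_{i,j}(c1,c2,c3,c4;N)`. -/
def A (q s c1 c2 c3 c4 t2 : ℂ) (N ε ε' i j : ℤ) : ℂ :=
  if ε = 0 ∧ ε' = 0 then
    -((1 - c3 * q ^ (N + 1 - j)) * (s * t2) / (1 - c1 * c2 * q ^ (N + 2 - j)))
          * ∑ e ∈ ({-1, 0, 1} : Finset ℤ), Aaux q s c1 c2 c3 c4 t2 N e 1 i j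
      - (1 - c1 * c2 * q ^ (N + 1 - j)) / ((1 - c3 * q ^ (N - j)) * (s * t2))
          * ∑ e ∈ ({-1, 0, 1} : Finset ℤ), Aaux q s c1 c2 c3 c4 t2 N e (-1) i j
      - ∑ e ∈ ({-1, 1} : Finset ℤ), Aaux q s c1 c2 c3 c4 t2 N e 0 i j
  else Aaux q s c1 c2 c3 c4 t2 N ε ε' i j

/-- `Λ(x;c1,c2,c3,c4;N)`; `s, t1, t2, t3, t4` are the chosen square roots of
`q, c1, c2, c3, c4`. -/
def Lam (q s c1 c2 c3 c4 t1 t2 t3 t4 : ℂ) (N x : ℤ) : ℂ :=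
  (-1 : ℂ) ^ x * binom q N x * (1 - c1 * c2 * q ^ (2 * x + 1)) * poch q (q * c2) x.toNat
      * (s * t2) ^ N * (t1 * t3 / (t2 * t4)) ^ x * q ^ (x * (x - 1) / 2)
    / (poch q (q * c1) x.toNat * poch q (q ^ (x + 1) * c1 * c2) (N + 1).toNat)

/-- Tratnik polynomial of q-Racah type `T_{i,j}(x,y;c1,c2,c3,c4;N)`; the fifth parameter
`c0 = (q^{2N+3} c1 c2 c3 c4)⁻¹` and its square root `t0 = (s^{2N+3} t1 t2 t3 t4)⁻¹`
are computed internally. -/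
def T (q s c1 c2 c3 c4 t1 t2 t3 t4 : ℂ) (N i j x y : ℤ) : ℂ :=
  if 0 ≤ i ∧ 0 ≤ j ∧ i + j ≤ N then
    p q s c1 c2 c3 t2 (N - j) i x *
      p q s c3 ((q ^ (2 * N + 3) * c1 * c2 * c3 * c4)⁻¹) c4
        ((s ^ (2 * N + 3) * t1 * t2 * t3 * t4)⁻¹) (N - x) j y
  else 0

/-- Griffiths polynomial of q-Racah type `G_{i,j}(x,y;c1,c2,c3,c4;N)`; the fifth parameter
`c0 = (q^{2N+3} c1 c2 c3 c4)⁻¹` and its square root `t0 = (s^{2N+3} t1 t2 t3 t4)⁻¹`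
are computed internally. -/
def G (q s c1 c2 c3 c4 t1 t2 t3 t4 : ℂ) (N i j x y : ℤ) : ℂ :=
  if 0 ≤ i ∧ 0 ≤ j ∧ i + j ≤ N then
    ∑ a ∈ Finset.range ((min (N - j) (N - y)).toNat + 1),
      om q (t1 * t2 * t3 / t4) (a : ℤ) * p q s c1 c2 c3 t2 (N - j) i (a : ℤ) *
        p q s c3 ((q ^ (2 * N + 3) * c1 * c2 * c3 * c4)⁻¹) c4
          ((s ^ (2 * N + 3) * t1 * t2 * t3 * t4)⁻¹) (N - (a : ℤ)) j y *
        p q s c4 c2 c1 t2 (N - y) (a : ℤ) x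
  else 0

end qR

namespace qR

lemma poch_zero (q a : ℂ) : poch q a 0 = 1 := by simp [poch]
lemma poch_succ (q a : ℂ) (k : ℕ) : poch q a (k+1) = poch q a k * (1 - a * q ^ k) := by
  simp [poch, Finset.prod_range_succ]
lemma poch_succ' (q a : ℂ) (k : ℕ) : poch q a (k+1) = (1 - a) * poch q (a * q) k := by
  simp only [poch, Finset.prod_range_succ', pow_zero, mul_one]
  rw [mul_comm]
  congr 1
  apply Finset.prod_congr rfl
  intro l _
  ring
lemma poch_ne (q a : ℂ) (k : ℕ) (h : ∀ l, l < k → a * q ^ l ≠ 1) : poch q a k ≠ 0 := by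
  rw [poch, Finset.prod_ne_zero_iff]
  intro l hl h0
  exact h l (Finset.mem_range.1 hl) (by linear_combination -h0)
lemma poch_add (q a : ℂ) (k m : ℕ) : poch q a (k+m) = poch q a k * poch q (a * q ^ k) m := by
  simp only [poch, Finset.prod_range_add]
  congr 1
  apply Finset.prod_congr rfl
  intro l _
  ring
lemma poch_eq_zero (q : ℂ) (hq : q ≠ 0) (n k : ℕ) (h : n < k) : poch q (q ^ n)⁻¹ k = 0 := by
  rw [poch, Finset.prod_eq_zero (Finset.mem_range.2 h)]
  field_simp
  simp

def ph (q a : ℂ) (k : ℕ) (X : ℂ) : ℂ := poch q X⁻¹ k * poch q (a * q * X) k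
def lm (q b Y : ℂ) : ℂ := (1 - Y⁻¹) * (1 - b * q * Y)
def BB (q c1 c2 c3 m X : ℂ) : ℂ :=
  (1 - X / m) * (1 - c1 * c2 * c3 * q^2 * X * m) * (1 - c2 * q * X) * (1 - c1 * c2 * q * X)
    / ((1 - c1 * c2 * q * X^2) * (1 - c1 * c2 * q^2 * X^2))
def DD (q c1 c2 c3 m X : ℂ) : ℂ :=
  -c2 * (X / m) * (1 - X) * (1 - c3 * q * m / X) * (1 - c1 * c2 * q * X * m) * (1 - c1 * X)
    / ((1 - c1 * c2 * X^2) * (1 - c1 * c2 * q * X^2))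
def mu (q c1 c2 c3 m Q : ℂ) : ℂ :=
  (1 - c2 * Q * q) * (1 - c1 * c2 * c3 * q^2 * m * Q) * (1 - Q / m) * (1 - Q * q) / (Q * q)

lemma op_succ (q c1 c2 c3 m X : ℂ) (k : ℕ) (hq : q ≠ 0) (hX : X ≠ 0) (hm : m ≠ 0)
    (h0 : X = 1 ∨ 1 - c1 * c2 * X^2 ≠ 0) (h1 : 1 - c1 * c2 * q * X^2 ≠ 0)
    (h2 : 1 - c1 * c2 * q^2 * X^2 ≠ 0) :
    BB q c1 c2 c3 m X * (ph q (c1 * c2) (k+1) (X * q) - ph q (c1 * c2) (k+1) X)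
      + DD q c1 c2 c3 m X * (ph q (c1 * c2) (k+1) (X / q) - ph q (c1 * c2) (k+1) X)
      = - lm q (c2 * c3) (q ^ (k+1)) * ph q (c1 * c2) (k+1) X
        - mu q c1 c2 c3 m (q ^ k) * ph q (c1 * c2) k X := by
  have hQ : q ^ k ≠ 0 := pow_ne_zero _ hq
  by_cases hX1 : X = 1
  · subst hX1
    have hD : DD q c1 c2 c3 m 1 = 0 := by simp [DD]
    rw [hD]
    simp only [mul_one, one_pow] at h1 h2
    rcases k with _ | k
    · simp only [ph, BB, mu, lm, poch_succ, poch_zero, zero_add, pow_zero, pow_one]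
      field_simp
      ring
    · simp only [ph]
      have e1 : poch q (1 * q)⁻¹ (k+1+1) = 0 := by
        have := poch_eq_zero q hq 1 (k+1+1) (by omega)
        simpa using this
      have e2 : ∀ k, poch q (1)⁻¹ (k+1) = 0 := by
        intro k
        have := poch_eq_zero q hq 0 (k+1) (by omega)
        simpa using this
      rw [e1, e2, e2]
      ring
  · have h0 := h0.resolve_left hX1
    have e1 : (1 - c1 * c2 * q * X) * poch q (c1 * c2 * q * (X * q)) (k+1)
        = poch q (c1 * c2 * q * X) k * (1 - c1 * c2 * q * X * q ^ k)
          * (1 - c1 * c2 * q * X * q ^ (k+1)) := by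
      rw [← poch_succ, ← poch_succ, poch_succ' q _ (k+1)]
      ring_nf
    have e2 : poch q (X * q)⁻¹ (k+1) = (1 - (X * q)⁻¹) * poch q X⁻¹ k := by
      rw [poch_succ']
      congr 2
      field_simp
    have e3 : (1 - X) * poch q (X / q)⁻¹ (k+1) = - X * (poch q X⁻¹ k * (1 - X⁻¹ * q ^ k)
          * (1 - X⁻¹ * q ^ (k+1))) := by
      rw [← poch_succ, ← poch_succ, poch_succ' q _ (k+1)]
      rw [show (X / q)⁻¹ = X⁻¹ * q by field_simp]
      field_simp
      ring
    have e4 : poch q (c1 * c2 * q * (X / q)) (k+1) = (1 - c1 * c2 * X) * poch q (c1 * c2 * q * X) k := by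
      rw [poch_succ']
      rw [show c1 * c2 * q * (X / q) = c1 * c2 * X by field_simp]
      rw [show c1 * c2 * X * q = c1 * c2 * q * X by ring]
    have f1 : BB q c1 c2 c3 m X * ph q (c1 * c2) (k+1) (X * q) =
        (1 - X / m) * (1 - c1 * c2 * c3 * q^2 * X * m) * (1 - c2 * q * X)
        / ((1 - c1 * c2 * q * X^2) * (1 - c1 * c2 * q^2 * X^2)) *
        (poch q (c1 * c2 * q * X) k * (1 - c1 * c2 * q * X * q ^ k)
          * (1 - c1 * c2 * q * X * q ^ (k+1))) * ((1 - (X * q)⁻¹) * poch q X⁻¹ k) := by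
      rw [← e1, ← e2, BB, ph]; ring
    have f2 : DD q c1 c2 c3 m X * ph q (c1 * c2) (k+1) (X / q) =
        -c2 * (X / m) * (1 - c3 * q * m / X) * (1 - c1 * c2 * q * X * m) * (1 - c1 * X)
        / ((1 - c1 * c2 * X^2) * (1 - c1 * c2 * q * X^2)) *
        (- X * (poch q X⁻¹ k * (1 - X⁻¹ * q ^ k)
          * (1 - X⁻¹ * q ^ (k+1)))) * ((1 - c1 * c2 * X) * poch q (c1 * c2 * q * X) k) := by
      rw [← e3, ← e4, DD, ph]; ring
    rw [mul_sub, mul_sub, f1, f2]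
    simp only [ph, BB, DD, mu, lm, poch_succ, pow_succ]
    generalize poch q X⁻¹ k = P1
    generalize poch q (c1 * c2 * q * X) k = P2
    generalize q ^ k = Q at *
    have key : ∀ u : ℂ, u = 0 → P1 * P2 * u = 0 := by rintro u rfl; simp
    rw [← sub_eq_zero]
    refine Eq.trans ?_ (key ((1 - X / m) * (1 - c1 * c2 * c3 * q^2 * X * m) * (1 - c2 * q * X)
        / ((1 - c1 * c2 * q * X^2) * (1 - c1 * c2 * q^2 * X^2)) * (1 - c1 * c2 * q * X * Q) *
        ((1 - c1 * c2 * q * X * (Q * q)) * (1 - (X * q)⁻¹) - (1 - c1 * c2 * q * X) * (1 - X⁻¹ * Q))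
        + c2 * (X / m) * (1 - c3 * q * m / X) * (1 - c1 * c2 * q * X * m) * (1 - c1 * X)
        / ((1 - c1 * c2 * X^2) * (1 - c1 * c2 * q * X^2)) * (1 - X⁻¹ * Q) *
        (X * (1 - X⁻¹ * (Q * q)) * (1 - c1 * c2 * X) + (1 - X) * (1 - c1 * c2 * q * X * Q))
        + (1 - (Q * q)⁻¹) * (1 - c2 * c3 * q * (Q * q)) * (1 - X⁻¹ * Q) * (1 - c1 * c2 * q * X * Q)
        + (1 - c2 * Q * q) * (1 - c1 * c2 * c3 * q^2 * m * Q) * (1 - Q / m) * (1 - Q * q) / (Q * q)) ?_)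
    · ring
    · have g1 : (1 - c1 * c2 * q * X * (Q * q)) * (1 - (X * q)⁻¹) - (1 - c1 * c2 * q * X) * (1 - X⁻¹ * Q) = (1 - Q * q) * (1 - c1 * c2 * q^2 * X^2) * (-1 / (X * q)) := by
        field_simp
        ring
      have g2 : X * (1 - X⁻¹ * (Q * q)) * (1 - c1 * c2 * X) + (1 - X) * (1 - c1 * c2 * q * X * Q)
         = (1 - Q * q) * (1 - c1 * c2 * X ^2) := by
        field_simp
        ring
      rw [g1, g2]
      clear e1 e2 e3 e4 f1 f2 g1 g2 key
      generalize hE0 : 1 - c1 * c2 * X^2 = E0 at *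
      generalize hE1 : 1 - c1 * c2 * q * X^2 = E1 at *
      generalize hE2 : 1 - c1 * c2 * q^2 * X^2 = E2 at *
      field_simp
      rw [← hE1]
      ring

end qR

namespace qR

structure Gen (q c1 c2 c3 : ℂ) (M : ℕ) : Prop where
  hq : q ≠ 0
  h1 : c1 ≠ 0
  h2 : c2 ≠ 0
  h3 : c3 ≠ 0
  gq : ∀ k, 1 ≤ k → k ≤ M → q ^ k ≠ 1
  g1 : ∀ k, 1 ≤ k → k ≤ M → c1 * q ^ k ≠ 1
  g2 : ∀ k, 1 ≤ k → k ≤ M → c2 * q ^ k ≠ 1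
  g3 : ∀ k, 1 ≤ k → k ≤ M → c3 * q ^ k ≠ 1
  g12 : ∀ k, 1 ≤ k → k ≤ 2 * M + 2 → c1 * c2 * q ^ k ≠ 1
  g23 : ∀ k, 1 ≤ k → k ≤ 2 * M + 2 → c2 * c3 * q ^ k ≠ 1
  g123 : ∀ k, M + 2 ≤ k → k ≤ 2 * M + 1 → c1 * c2 * c3 * q ^ k ≠ 1

lemma Gen.symm {q c1 c2 c3 : ℂ} {M : ℕ} (g : Gen q c1 c2 c3 M) : Gen q c3 c2 c1 M where
  hq := g.hq
  h1 := g.h3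
  h2 := g.h2
  h3 := g.h1
  gq := g.gq
  g1 := g.g3
  g2 := g.g2
  g3 := g.g1
  g12 := by intro k h h'; rw [mul_comm c3]; exact g.g23 k h h'
  g23 := by intro k h h'; rw [mul_comm c2]; exact g.g12 k h h'
  g123 := by
    intro k h h'
    rw [show c3 * c2 * c1 = c1 * c2 * c3 by ring]; exact g.g123 k h h'

lemma Gen.shift {q c1 c2 c3 : ℂ} {M : ℕ} (g : Gen q c1 c2 c3 (M+1)) :
    Gen q c1 (q * c2) (q * c3) M where
  hq := g.hq
  h1 := g.h1
  h2 := mul_ne_zero g.hq g.h2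
  h3 := mul_ne_zero g.hq g.h3
  gq := fun k h h' => g.gq k h (by omega)
  g1 := fun k h h' => g.g1 k h (by omega)
  g2 := fun k h h' => by
    have := g.g2 (k+1) (by omega) (by omega)
    rwa [show q * c2 * q ^ k = c2 * q ^ (k+1) by ring]
  g3 := fun k h h' => by
    have := g.g3 (k+1) (by omega) (by omega)
    rwa [show q * c3 * q ^ k = c3 * q ^ (k+1) by ring]
  g12 := fun k h h' => by
    have := g.g12 (k+1) (by omega) (by omega)
    rwa [show c1 * (q * c2) * q ^ k = c1 * c2 * q ^ (k+1) by ring]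
  g23 := fun k h h' => by
    have := g.g23 (k+2) (by omega) (by omega)
    rwa [show (q * c2) * (q * c3) * q ^ k = c2 * c3 * q ^ (k+2) by ring]
  g123 := fun k h h' => by
    have := g.g123 (k+2) (by omega) (by omega)
    rwa [show c1 * (q * c2) * (q * c3) * q ^ k = c1 * c2 * c3 * q ^ (k+2) by ring]

/-- denominators of the 4phi3 -/
def dn (q c1 c2 c3 : ℂ) (M k : ℕ) : ℂ :=
  poch q (q * c2) k * poch q (c1 * c2 * c3 * q ^ (M + 2)) k * poch q (q ^ M)⁻¹ k * poch q q k

lemma sub_ne {a : ℂ} (h : a ≠ 1) : 1 - a ≠ 0 := fun h' => h (by linear_combination -h')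

def RC (q c1 c2 c3 : ℂ) (M : ℕ) (Y X : ℂ) : ℂ :=
  ∑ k ∈ Finset.range (M + 1), q ^ k / dn q c1 c2 c3 M k * (ph q (c2 * c3) k Y * ph q (c1 * c2) k X)

lemma RC_symm (q c1 c2 c3 : ℂ) (M : ℕ) (Y X : ℂ) : RC q c1 c2 c3 M Y X = RC q c3 c2 c1 M X Y := by
  unfold RC dn
  apply Finset.sum_congr rfl
  intro k _
  rw [mul_comm (ph q (c2 * c3) k Y), mul_comm c3 c2, mul_comm c1 c2,
    show c2 * c1 * c3 = c2 * c3 * c1 by ring]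

lemma ph_one (q a : ℂ) (hq : q ≠ 0) (k : ℕ) : ph q a (k+1) 1 = 0 := by
  have := poch_eq_zero q hq 0 (k+1) (by omega)
  simp only [pow_zero] at this
  rw [ph, this, zero_mul]

lemma RC_one (q c1 c2 c3 : ℂ) (hq : q ≠ 0) (M : ℕ) (Y : ℂ) : RC q c1 c2 c3 M Y 1 = 1 := by
  unfold RC
  rw [Finset.sum_eq_single 0]
  · simp [dn, ph, poch_zero]
  · intro k _ hk
    obtain ⟨k, rfl⟩ := Nat.exists_eq_succ_of_ne_zero hk
    rw [Nat.succ_eq_add_one, ph_one q _ hq]; simp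
  · simp

lemma dn_step {q c1 c2 c3 : ℂ} {M : ℕ} (g : Gen q c1 c2 c3 M) (k : ℕ) (hk : k < M) (Y : ℂ) (hY : Y ≠ 0) :
    q ^ (k+1) / dn q c1 c2 c3 M (k+1) * ph q (c2 * c3) (k+1) Y * mu q c1 c2 c3 (q ^ M) (q ^ k)
    = q ^ k / dn q c1 c2 c3 M k * ph q (c2 * c3) k Y * (lm q (c2 * c3) Y - lm q (c2 * c3) (q ^ k)) := by
  have a1 : 1 - c2 * q ^ (k+1) ≠ 0 := sub_ne (g.g2 (k+1) (by omega) (by omega))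
  have a2 : 1 - c1 * c2 * c3 * q ^ (M + 2 + k) ≠ 0 := sub_ne (g.g123 _ (by omega) (by omega))
  have a3 : 1 - q ^ (k+1) ≠ 0 := sub_ne (g.gq _ (by omega) (by omega))
  have a4 : 1 - q ^ k / q ^ M ≠ 0 := by
    have := sub_ne (g.gq (M - k) (by omega) (by omega))
    intro h
    apply this
    have hM : q ^ M = q ^ (M - k) * q ^ k := by rw [← pow_add]; congr 1; omega
    have hk0 : q ^ k ≠ 0 := pow_ne_zero _ g.hq
    have hk1 : q ^ (M-k) ≠ 0 := pow_ne_zero _ g.hq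
    rw [hM] at h
    field_simp at h
    linear_combination -h
  have e : dn q c1 c2 c3 M (k+1) = dn q c1 c2 c3 M k * ((1 - c2 * q ^ (k+1)) *
     (1 - c1 * c2 * c3 * q ^ (M + 2 + k)) * (1 - q ^ k / q ^ M) * (1 - q ^ (k+1))) := by
    simp only [dn, poch_succ]
    ring
  have e2 : mu q c1 c2 c3 (q ^ M) (q ^ k) = ((1 - c2 * q ^ (k+1)) *
     (1 - c1 * c2 * c3 * q ^ (M + 2 + k)) * (1 - q ^ k / q ^ M) * (1 - q ^ (k+1))) / q ^ (k+1) := by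
    simp only [mu]
    ring
  have hq1 : q ^ (k+1) ≠ 0 := pow_ne_zero _ g.hq
  have hq2 : q ^ k ≠ 0 := pow_ne_zero _ g.hq
  have e3 : lm q (c2 * c3) Y - lm q (c2 * c3) (q ^ k) = (1 - Y⁻¹ * q ^ k) * (1 - c2 * c3 * q * Y * q ^ k) / q ^ k := by
    simp only [lm]
    field_simp
    ring
  rw [e, e2, e3]
  have hZ := mul_ne_zero (mul_ne_zero (mul_ne_zero a1 a2) a4) a3
  clear e e2 e3 a1 a2 a3 a4
  generalize (1 - c2 * q ^ (k+1)) *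
     (1 - c1 * c2 * c3 * q ^ (M + 2 + k)) * (1 - q ^ k / q ^ M) * (1 - q ^ (k+1)) = Z at *
  simp only [ph, poch_succ]
  generalize dn q c1 c2 c3 M k = d
  field_simp

lemma diffeq {q c1 c2 c3 : ℂ} {M : ℕ} (g : Gen q c1 c2 c3 M) (n : ℕ) (hn : n ≤ M) (X : ℂ)
    (hX : X ≠ 0) (h0 : X = 1 ∨ 1 - c1 * c2 * X^2 ≠ 0) (h1 : 1 - c1 * c2 * q * X^2 ≠ 0)
    (h2 : 1 - c1 * c2 * q^2 * X^2 ≠ 0) :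
    BB q c1 c2 c3 (q ^ M) X * (RC q c1 c2 c3 M (q ^ n) (X * q) - RC q c1 c2 c3 M (q ^ n) X)
      + DD q c1 c2 c3 (q ^ M) X * (RC q c1 c2 c3 M (q ^ n) (X / q) - RC q c1 c2 c3 M (q ^ n) X)
      = - lm q (c2 * c3) (q ^ n) * RC q c1 c2 c3 M (q ^ n) X := by
  have hY : q ^ n ≠ 0 := pow_ne_zero _ g.hq
  have key : ∀ K, K ≤ M → ∑ k ∈ Finset.range (K+1), q ^ k / dn q c1 c2 c3 M k * (ph q (c2 * c3) k (q ^ n) *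
      (BB q c1 c2 c3 (q ^ M) X * (ph q (c1 * c2) k (X * q) - ph q (c1 * c2) k X)
      + DD q c1 c2 c3 (q ^ M) X * (ph q (c1 * c2) k (X / q) - ph q (c1 * c2) k X)
       + lm q (c2 * c3) (q ^ n) * ph q (c1 * c2) k X)) =
      q ^ K / dn q c1 c2 c3 M K * ph q (c2 * c3) K (q ^ n) *
        (lm q (c2 * c3) (q ^ n) - lm q (c2 * c3) (q ^ K)) * ph q (c1 * c2) K X := by
    intro K
    induction K with
    | zero =>
      intro _
      simp [ph, poch_zero, lm]
    | succ K ih =>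
      intro hK
      rw [Finset.sum_range_succ, ih (by omega),
        op_succ q c1 c2 c3 (q ^ M) X K g.hq hX (pow_ne_zero _ g.hq) h0 h1 h2,
        ← dn_step g K (by omega) _ hY]
      ring
  have hM := key M le_rfl
  have hz : q ^ M / dn q c1 c2 c3 M M * ph q (c2 * c3) M (q ^ n) *
        (lm q (c2 * c3) (q ^ n) - lm q (c2 * c3) (q ^ M)) * ph q (c1 * c2) M X = 0 := by
    rcases hn.eq_or_lt with rfl | h
    · simp
    · rw [ph, poch_eq_zero q g.hq n M h]; simp
  rw [hz] at hM
  rw [← sub_eq_zero, ← hM]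
  simp only [RC, ← Finset.sum_sub_distrib, Finset.mul_sum, ← Finset.sum_add_distrib]
  apply Finset.sum_congr rfl
  intro k _
  ring

def W (q c1 c2 c3 : ℂ) (M n : ℕ) : ℂ :=
  poch q q M / (poch q q n * poch q q (M - n)) * (1 - c2 * c3 * q ^ (2 * n + 1)) * poch q (q * c2) n
      * poch q (c1 * c2 * c3 * q ^ (M + 2)) n * poch q (q * c1) (M - n)
    / ((q * c2) ^ n * poch q (c2 * c3 * q ^ (n + 1)) (M + 1) * poch q (q * c3) n)

lemma W_step {q c1 c2 c3 : ℂ} {M : ℕ} (g : Gen q c1 c2 c3 M) (x : ℕ) (hx : x < M) :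
    W q c3 c2 c1 M x * BB q c1 c2 c3 (q ^ M) (q ^ x) =
    W q c3 c2 c1 M (x+1) * DD q c1 c2 c3 (q ^ M) (q ^ (x+1)) := by
  obtain ⟨r, rfl⟩ : ∃ r, M = x + 1 + r := ⟨M - (x+1), by omega⟩
  have r1 : x + 1 + r - x = r + 1 := by omega
  have r2 : x + 1 + r - (x + 1) = r := by omega
  have hq := g.hq
  have h2 := g.h2
  have hX : q ^ x ≠ 0 := pow_ne_zero _ hq
  have hR : q ^ r ≠ 0 := pow_ne_zero _ hq
  have a1 : 1 - q ^ (x+1) ≠ 0 := sub_ne (g.gq _ (by omega) (by omega))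
  have a2 : 1 - q ^ (r+1) ≠ 0 := sub_ne (g.gq _ (by omega) (by omega))
  have a3 : 1 - c2 * c1 * q ^ (2 * x + 1) ≠ 0 := sub_ne (by rw [mul_comm c2]; exact g.g12 _ (by omega) (by omega))
  have a4 : 1 - c2 * c1 * q ^ (2 * x + 2) ≠ 0 := sub_ne (by rw [mul_comm c2]; exact g.g12 _ (by omega) (by omega))
  have a5 : 1 - c2 * c1 * q ^ (2 * x + 3) ≠ 0 := sub_ne (by rw [mul_comm c2]; exact g.g12 _ (by omega) (by omega))
  have a6 : 1 - c2 * c1 * q ^ (x + 1) ≠ 0 := sub_ne (by rw [mul_comm c2]; exact g.g12 _ (by omega) (by omega))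
  have a7 : 1 - c2 * c1 * q ^ (2 * x + r + 3) ≠ 0 := sub_ne (by rw [mul_comm c2]; exact g.g12 _ (by omega) (by omega))
  have a8 : 1 - c1 * q ^ (x+1) ≠ 0 := sub_ne (g.g1 _ (by omega) (by omega))
  have a9 : 1 - c3 * q ^ (r+1) ≠ 0 := sub_ne (g.g3 _ (by omega) (by omega))
  have e1 : poch q (c2 * c1 * q ^ (x+1)) (x + 1 + r + 1) = (1 - c2 * c1 * q ^ (x + 1)) *
     poch q (c2 * c1 * q ^ (x+1+1)) (x + 1 + r) := by
    rw [poch_succ', pow_succ q (x+1)]; ring_nf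
  have e2 : poch q (c2 * c1 * q ^ (x+1+1)) (x + 1 + r + 1) = 
     poch q (c2 * c1 * q ^ (x+1+1)) (x + 1 + r) * (1 - c2 * c1 * q ^ (2 * x + r + 3)) := by
    rw [poch_succ]; ring_nf
  have e3 : poch q q (r+1) = poch q q r * (1 - q ^ (r+1)) := by rw [poch_succ]; ring
  have e4 : poch q q (x+1) = poch q q x * (1 - q ^ (x+1)) := by rw [poch_succ]; ring
  have e5 : poch q (q * c3) (r+1) = poch q (q * c3) r * (1 - c3 * q ^ (r+1)) := by rw [poch_succ]; ring
  have e6 : poch q (q * c1) (x+1) = poch q (q * c1) x * (1 - c1 * q ^ (x+1)) := by rw [poch_succ]; ring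
  have e7 : poch q (q * c2) (x+1) = poch q (q * c2) x * (1 - c2 * q ^ (x+1)) := by rw [poch_succ]; ring
  have e8 : poch q (c3 * c2 * c1 * q ^ (x + 1 + r + 2)) (x+1) =
     poch q (c3 * c2 * c1 * q ^ (x + 1 + r + 2)) x * (1 - c3 * c2 * c1 * q ^ (2 * x + r + 3)) := by
    rw [poch_succ]; ring
  have b1 : BB q c1 c2 c3 (q ^ (x+1+r)) (q ^ x) =
    (1 - q ^ (r+1)) * (-1 / q ^ (r+1)) * (1 - c3 * c2 * c1 * q ^ (2 * x + r + 3)) * (1 - c2 * q ^ (x+1))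
      * (1 - c2 * c1 * q ^ (x + 1)) / ((1 - c2 * c1 * q ^ (2 * x + 1)) * (1 - c2 * c1 * q ^ (2 * x + 2))) := by
    rw [BB, show 1 - q ^ x / q ^ (x+1+r) = (1 - q ^ (r+1)) * (-1 / q ^ (r+1)) by field_simp; ring]
    ring
  have b2 : DD q c1 c2 c3 (q ^ (x+1+r)) (q ^ (x+1)) =
    (-c2 / q ^ r) * (1 - q ^ (x+1)) * (1 - c3 * q ^ (r+1)) * (1 - c2 * c1 * q ^ (2 * x + r + 3)) * (1 - c1 * q ^ (x+1))
     / ((1 - c2 * c1 * q ^ (2 * x + 2)) * (1 - c2 * c1 * q ^ (2 * x + 3))) := by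
    rw [DD, show -c2 * (q ^ (x+1) / q ^ (x+1+r)) = -c2 / q ^ r by field_simp; ring,
      show c3 * q * q ^ (x+1+r) / q ^ (x+1) = c3 * q ^ (r+1) by field_simp; ring]
    ring
  rw [b1, b2, W, W, r1, r2, e1, e2, e3, e4, e5, e6, e7, e8, show 2 * (x+1) + 1 = 2 * x + 3 by ring, pow_succ (q * c2),
    pow_succ q r]
  rw [pow_succ q r] at a2 a9
  clear e1 e2 e3 e4 e5 e6 e7 e8 b1 b2 r1 r2
  generalize 1 - q ^ (x+1) = A1 at *
  generalize 1 - q ^ r * q = A2 at *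
  generalize 1 - c2 * c1 * q ^ (2 * x + 1) = A3 at *
  generalize 1 - c2 * c1 * q ^ (2 * x + 2) = A4 at *
  generalize 1 - c2 * c1 * q ^ (2 * x + 3) = A5 at *
  generalize 1 - c2 * c1 * q ^ (x + 1) = A6 at *
  generalize 1 - c2 * c1 * q ^ (2 * x + r + 3) = A7 at *
  generalize 1 - c1 * q ^ (x+1) = A8 at *
  generalize 1 - c3 * (q ^ r * q) = A9 at *
  generalize 1 - c2 * q ^ (x+1) = A10 at *
  generalize 1 - c3 * c2 * c1 * q ^ (2 * x + r + 3) = A11 at *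
  generalize poch q (c2 * c1 * q ^ (x+1+1)) (x + 1 + r) = Z1
  generalize poch q (c3 * c2 * c1 * q ^ (x + 1 + r + 2)) x = Z2
  generalize poch q q x = Z3
  generalize poch q q r = Z4
  generalize poch q (q * c1) x = Z5
  have hx2 : (q * c2) ^ x ≠ 0 := pow_ne_zero _ (mul_ne_zero hq h2)
  generalize (q * c2) ^ x = Z6 at *
  field_simp

lemma lm_inj {q c1 c2 c3 : ℂ} {M : ℕ} (g : Gen q c1 c2 c3 M) (n m : ℕ) (hnm : n < m) (hm : m ≤ M) :
    lm q (c2 * c3) (q ^ m) - lm q (c2 * c3) (q ^ n) ≠ 0 := by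
  obtain ⟨d, rfl⟩ : ∃ d, m = n + d := ⟨m - n, by omega⟩
  have hq := g.hq
  have e : lm q (c2 * c3) (q ^ (n+d)) - lm q (c2 * c3) (q ^ n) =
    (1 - q ^ d) * (-1 / q ^ (n + d)) * (1 - c2 * c3 * q ^ (2 * n + d + 1)) := by
    rw [lm, lm]
    field_simp
    ring
  rw [e]
  refine mul_ne_zero (mul_ne_zero (sub_ne (g.gq _ (by omega) (by omega))) ?_) (sub_ne (g.g23 _ (by omega) (by omega)))
  exact div_ne_zero (by norm_num) (pow_ne_zero _ hq)

lemma orth {q c1 c2 c3 : ℂ} {M : ℕ} (g : Gen q c1 c2 c3 M) (n m : ℕ) (hn : n ≤ M) (hm : m ≤ M) (hnm : n ≠ m) :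
    ∑ x ∈ Finset.range (M+1), W q c3 c2 c1 M x * RC q c1 c2 c3 M (q ^ n) (q ^ x) * RC q c1 c2 c3 M (q ^ m) (q ^ x) = 0 := by
  wlog h : n < m generalizing n m
  · rw [← this m n hm hn hnm.symm (by omega)]
    apply Finset.sum_congr rfl
    intros; ring
  have hq := g.hq
  have d : ∀ n, n ≤ M → ∀ x, x ≤ M → _ := fun n hn x hx => diffeq g n hn (q ^ x) (pow_ne_zero _ hq)
    (by
      rcases x with _ | x
      · left; simp
      · right
        have := sub_ne (g.g12 (2 * (x+1)) (by omega) (by omega))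
        rwa [pow_mul', ] at this)
    (by
      have := sub_ne (g.g12 (2 * x + 1) (by omega) (by omega))
      rwa [show c1 * c2 * q ^ (2 * x + 1) = c1 * c2 * q * (q ^ x)^2 by ring] at this)
    (by
      have := sub_ne (g.g12 (2 * x + 2) (by omega) (by omega))
      rwa [show c1 * c2 * q ^ (2 * x + 2) = c1 * c2 * q^2 * (q ^ x)^2 by ring] at this)
  have key : ∀ K, K ≤ M → ∑ x ∈ Finset.range (K+1), W q c3 c2 c1 M x * RC q c1 c2 c3 M (q ^ n) (q ^ x) * RC q c1 c2 c3 M (q ^ m) (q ^ x)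
      * (lm q (c2 * c3) (q ^ m) - lm q (c2 * c3) (q ^ n)) = W q c3 c2 c1 M K * BB q c1 c2 c3 (q ^ M) (q ^ K) *
       (RC q c1 c2 c3 M (q ^ n) (q ^ (K+1)) * RC q c1 c2 c3 M (q ^ m) (q ^ K) - RC q c1 c2 c3 M (q ^ n) (q ^ K) * RC q c1 c2 c3 M (q ^ m) (q ^ (K+1))) := by
    intro K
    induction K with
    | zero =>
      intro _
      have d1 := d n hn 0 (by omega)
      have d2 := d m hm 0 (by omega)
      have hD : DD q c1 c2 c3 (q ^ M) (q ^ 0) = 0 := by simp [DD]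
      rw [hD, ← pow_succ] at d1 d2
      rw [Finset.sum_range_one]
      linear_combination W q c3 c2 c1 M 0 * (RC q c1 c2 c3 M (q ^ n) (q ^ 0)) * d2 - W q c3 c2 c1 M 0 * (RC q c1 c2 c3 M (q ^ m) (q ^ 0)) * d1
    | succ K ih =>
      intro hK
      have d1 := d n hn (K+1) (by omega)
      have d2 := d m hm (K+1) (by omega)
      have hs := W_step g K (by omega)
      rw [show q ^ (K+1) / q = q ^ K by field_simp; ring, ← pow_succ] at d1 d2
      rw [Finset.sum_range_succ, ih (by omega), hs]
      linear_combination W q c3 c2 c1 M (K+1) * (RC q c1 c2 c3 M (q ^ n) (q ^ (K+1))) * d2 - W q c3 c2 c1 M (K+1) * (RC q c1 c2 c3 M (q ^ m) (q ^ (K+1))) * d1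
  have hM := key M le_rfl
  have hB : BB q c1 c2 c3 (q ^ M) (q ^ M) = 0 := by simp [BB, hq]
  rw [hB, ← Finset.sum_mul] at hM
  have := lm_inj g n m h hm
  simpa [this] using hM

end qR

namespace qR

lemma RC_q (q c1 c2 c3 : ℂ) (hq : q ≠ 0) (M : ℕ) (X : ℂ) :
    RC q c1 c2 c3 (M+1) (q ^ 1) X = 1 + q / dn q c1 c2 c3 (M+1) 1 * ((1 - q⁻¹) * (1 - c2 * c3 * q ^ 2)
      * ph q (c1 * c2) 1 X) := by
  rw [RC, Finset.sum_range_succ', Finset.sum_range_succ', Finset.sum_eq_zero]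
  · simp only [ph, dn, poch_succ, poch_zero]
    simp
    ring
  · intro k _
    rw [ph, poch_eq_zero q hq 1 (k+1+1) (by omega)]
    simp

set_option maxHeartbeats 1000000 in
lemma W_shift {q c1 c2 c3 : ℂ} {M : ℕ} (g : Gen q c1 c2 c3 (M+1)) (x : ℕ) (hx : x ≤ M) :
    W q c1 c2 c3 (M+1) (x+1) * ph q (c2 * c3) 1 (q ^ (x+1)) =
    -(1 - q ^ (M+1)) * (1 - q * c2) * (1 - c1 * c2 * c3 * q ^ (M+3)) / (q^2 * c2 * (1 - q * c3))
      * W q c1 (q * c2) (q * c3) M x := by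
  have hq := g.hq
  have h2 := g.h2
  have a1 : 1 - q ^ (x+1) ≠ 0 := sub_ne (g.gq _ (by omega) (by omega))
  have a2 : 1 - c2 * c3 * q ^ (x+2) ≠ 0 := sub_ne (g.g23 _ (by omega) (by omega))
  have a3 : 1 - q * c3 ≠ 0 := sub_ne (by have := g.g3 1 (by omega) (by omega); rwa [pow_one, mul_comm] at this)
  have e1 : poch q q (x+1) = poch q q x * (1 - q ^ (x+1)) := by rw [poch_succ]; ring
  have e2 : poch q q (M+1) = poch q q M * (1 - q ^ (M+1)) := by rw [poch_succ]; ring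
  have e3 : poch q (q * c2) (x+1) = (1 - q * c2) * poch q (q * (q * c2)) x := by
    rw [poch_succ']; ring_nf
  have e4 : poch q (q * c3) (x+1) = (1 - q * c3) * poch q (q * (q * c3)) x := by
    rw [poch_succ']; ring_nf
  have e5 : poch q (c1 * c2 * c3 * q ^ (M + 1 + 2)) (x+1) = (1 - c1 * c2 * c3 * q ^ (M+3)) *
      poch q (c1 * (q * c2) * (q * c3) * q ^ (M+2)) x := by
    rw [poch_succ']; ring_nf
  have e6 : poch q (c2 * c3 * q ^ (x + 1 + 1)) (M + 1 + 1) = (1 - c2 * c3 * q ^ (x+2)) *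
      poch q ((q * c2) * (q * c3) * q ^ (x+1)) (M+1) := by
    rw [poch_succ' _ _ (M+1)]; ring_nf
  have e7 : ph q (c2 * c3) 1 (q ^ (x+1)) = (1 - q ^ (x+1)) * (-1 / q ^ (x+1)) * (1 - c2 * c3 * q ^ (x+2)) := by
    rw [ph, poch_succ, poch_succ, poch_zero, poch_zero]
    field_simp
    ring
  have e8 : (q * (q * c2)) ^ x = q ^ x * (q * c2) ^ x := by rw [← mul_pow]
  rw [e7, W, W, e1, e2, e3, e4, e5, e6, e8, show M + 1 - (x + 1) = M - x by omega]
  have b1 : (1 - c2 * c3 * q ^ (2 * (x+1) + 1)) = (1 - q * c2 * (q * c3) * q ^ (2 * x + 1)) := by ring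
  rw [b1, pow_succ (q * c2) x, pow_succ q x]
  rw [pow_succ q x] at a1
  clear e1 e2 e3 e4 e5 e6 e7 e8 b1
  have hx0 : q ^ x ≠ 0 := pow_ne_zero _ hq
  have hx2 : (q * c2) ^ x ≠ 0 := pow_ne_zero _ (mul_ne_zero hq h2)
  generalize (q * c2) ^ x = Z6 at *
  generalize 1 - q ^ x * q = A1 at *
  generalize 1 - c2 * c3 * q ^ (x+2) = A2 at *
  generalize 1 - q * c3 = A3 at *
  generalize poch q q x = Z1
  generalize poch q q (M - x) = Z2
  generalize poch q (q * (q * c2)) x = Z3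
  generalize poch q (q * (q * c3)) x = Z4
  generalize poch q (c1 * (q * c2) * (q * c3) * q ^ (M+2)) x = Z5
  generalize poch q ((q * c2) * (q * c3) * (q ^ x * q)) (M+1) = Z7
  generalize 1 - q * c2 * (q * c3) * q ^ (2 * x + 1) = A4
  generalize 1 - q ^ (M + 1) = A5
  generalize 1 - c1 * c2 * c3 * q ^ (M+3) = A6
  generalize 1 - q * c2 = A7
  generalize poch q (q * c1) (M - x) = Z8
  generalize poch q q M = Z9
  generalize q ^ x = Z10 at *
  field_simp

lemma W_sum (M : ℕ) : ∀ {q c1 c2 c3 : ℂ}, Gen q c1 c2 c3 M →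
    ∑ m ∈ Finset.range (M+1), W q c1 c2 c3 M m =
      poch q (c1 * c2 * q ^ 2) M / (poch q (q * c3) M * (q * c2) ^ M) := by
  induction M with
  | zero =>
    intro q c1 c2 c3 g
    have := sub_ne (g.g23 1 (by omega) (by omega))
    simp only [pow_one] at this
    simp [W, poch_zero, poch_succ, this]
  | succ M ih =>
    intro q c1 c2 c3 g
    have hq := g.hq
    have h2 := g.h2
    have ho := orth g.symm 0 1 (by omega) (by omega) (by omega)
    have ih := ih g.shift
    set C := q / dn q c3 c2 c1 (M+1) 1 * ((1 - q⁻¹) * (1 - c2 * c1 * q ^ 2)) with hC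
    have e : ∀ x, W q c1 c2 c3 (M+1) x * RC q c3 c2 c1 (M+1) (q ^ 0) (q ^ x) *
       RC q c3 c2 c1 (M+1) (q ^ 1) (q ^ x) = W q c1 c2 c3 (M+1) x + C * (W q c1 c2 c3 (M+1) x *
         ph q (c2 * c3) 1 (q ^ x)) := by
      intro x
      rw [RC_q q _ _ _ hq, RC_symm, pow_zero, RC_one q _ _ _ hq, hC, mul_comm c3 c2]
      ring
    simp only [e, Finset.sum_add_distrib, ← Finset.mul_sum] at ho
    rw [Finset.sum_range_succ' (fun x => W q c1 c2 c3 (M+1) x * ph q (c2 * c3) 1 (q ^ x)),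
      Finset.sum_congr rfl (fun x hx => W_shift g x (by have := Finset.mem_range.1 hx; omega)),
      ← Finset.mul_sum, ih, pow_zero, ph_one q _ hq 0] at ho
    have a1 : 1 - q ^ (M+1) ≠ 0 := sub_ne (g.gq _ (by omega) (by omega))
    have a2 : 1 - c1 * c2 * c3 * q ^ (M+3) ≠ 0 := sub_ne (g.g123 _ (by omega) (by omega))
    have a3 : 1 - q * c3 ≠ 0 := sub_ne (by have := g.g3 1 (by omega) (by omega); rwa [pow_one, mul_comm] at this)
    have a4 : 1 - q * c2 ≠ 0 := sub_ne (by have := g.g2 1 (by omega) (by omega); rwa [pow_one, mul_comm] at this)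
    have a5 : 1 - q ≠ 0 := sub_ne (by have := g.gq 1 (by omega) (by omega); rwa [pow_one] at this)
    have f1 : dn q c3 c2 c1 (M+1) 1 = (1 - q * c2) * (1 - c1 * c2 * c3 * q ^ (M+3)) *
        ((1 - q ^ (M+1)) * (-1 / q ^ (M+1))) * (1 - q) := by
      have hh : 1 - (q ^ (M+1))⁻¹ = ((1 - q ^ (M+1)) * (-1 / q ^ (M+1))) := by
        have : q ^ (M+1) ≠ 0 := pow_ne_zero _ hq
        field_simp
        ring
      rw [← hh, dn]
      simp only [poch_succ, poch_zero]
      ring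
    have f2 : poch q (c1 * c2 * q ^ 2) (M+1) = (1 - c1 * c2 * q^2) * poch q (c1 * (q * c2) * q ^ 2) M := by
      rw [poch_succ']; ring_nf
    have f3 : poch q (q * c3) (M+1) = (1 - q * c3) * poch q (q * (q * c3)) M := by
      rw [poch_succ']; ring_nf
    have f4 : (q * (q * c2)) ^ M = q ^ M * (q * c2) ^ M := by rw [← mul_pow]
    have f5 : 1 - q⁻¹ = (1 - q) * (-1 / q) := by field_simp; ring
    rw [f2, f3]
    rw [f1, f5] at hC
    rw [f4] at ho
    rw [eq_neg_of_add_eq_zero_left ho, hC, mul_comm c2 c1]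
    rw [pow_succ] at a1
    rw [pow_succ q M, pow_succ (q * c2)]
    clear ho hC f1 f2 f3 f4 f5 e ih g
    have hx0 : q ^ M ≠ 0 := pow_ne_zero _ hq
    have hx2 : (q * c2) ^ M ≠ 0 := pow_ne_zero _ (mul_ne_zero hq h2)
    generalize (q * c2) ^ M = Z6 at *
    generalize poch q (q * (q * c3)) M = Z1
    generalize poch q (c1 * (q * c2) * q ^ 2) M = Z2
    generalize 1 - q ^ M * q = A1 at *
    generalize 1 - c1 * c2 * c3 * q ^ (M+3) = A2 at *
    generalize 1 - q * c3 = A3 at *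
    generalize 1 - q * c2 = A4 at *
    generalize 1 - q = A5 at *
    generalize 1 - c1 * c2 * q^2 = A6 at *
    field_simp
    ring

lemma norm_W {q c1 c2 c3 : ℂ} {M : ℕ} (g : Gen q c1 c2 c3 M) (n : ℕ) (hn : n ≤ M) :
    W q c1 c2 c3 M n * ∑ x ∈ Finset.range (M+1), W q c3 c2 c1 M x * RC q c1 c2 c3 M (q ^ n) (q ^ x)
      * RC q c1 c2 c3 M (q ^ n) (q ^ x) = 1 / (q * c2) ^ M := by
  have hq := g.hq
  have hA : ∑ m ∈ Finset.range (M+1), ∑ x ∈ Finset.range (M+1), W q c1 c2 c3 M m *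
      (W q c3 c2 c1 M x * RC q c1 c2 c3 M (q ^ n) (q ^ x) * RC q c1 c2 c3 M (q ^ m) (q ^ x)) =
      W q c1 c2 c3 M n * ∑ x ∈ Finset.range (M+1), W q c3 c2 c1 M x * RC q c1 c2 c3 M (q ^ n) (q ^ x)
      * RC q c1 c2 c3 M (q ^ n) (q ^ x) := by
    simp only [← Finset.mul_sum]
    rw [Finset.sum_eq_single n]
    · intro m hm hmn
      rw [orth g n m hn (by have := Finset.mem_range.1 hm; omega) hmn.symm, mul_zero]
    · intro h
      exact absurd (Finset.mem_range.2 (by omega)) h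
  rw [← hA, Finset.sum_comm, Finset.sum_eq_single 0]
  · have : ∀ m, W q c1 c2 c3 M m * (W q c3 c2 c1 M 0 * RC q c1 c2 c3 M (q ^ n) (q ^ 0) *
        RC q c1 c2 c3 M (q ^ m) (q ^ 0)) = W q c3 c2 c1 M 0 * W q c1 c2 c3 M m := by
      intro m
      rw [pow_zero, RC_one q _ _ _ hq, RC_one q _ _ _ hq]; ring
    simp only [this]
    rw [← Finset.mul_sum, W_sum M g]
    have b1 : 1 - c2 * c1 * q ≠ 0 := sub_ne (by
      have := g.g12 1 (by omega) (by omega); rwa [pow_one, mul_comm c1] at this)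
    have b2 : poch q (c1 * c2 * q ^ 2) M ≠ 0 := poch_ne _ _ _ (by
      intro l hl
      have := g.g12 (l+2) (by omega) (by omega)
      rwa [show c1 * c2 * q ^ (l+2) = c1 * c2 * q ^ 2 * q ^ l by ring] at this)
    have b3 : poch q (q * c3) M ≠ 0 := poch_ne _ _ _ (by
      intro l hl
      have := g.g3 (l+1) (by omega) (by omega)
      rwa [show c3 * q ^ (l+1) = q * c3 * q ^ l by ring] at this)
    have b4 : poch q q M ≠ 0 := poch_ne _ _ _ (by
      intro l hl
      have := g.gq (l+1) (by omega) (by omega)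
      rwa [show q ^ (l+1) = q * q ^ l by ring] at this)
    have b5 : (q * c2) ^ M ≠ 0 := pow_ne_zero _ (mul_ne_zero hq g.h2)
    have f : poch q (c2 * c1 * q ^ (0+1)) (M+1) = (1 - c2 * c1 * q) * poch q (c1 * c2 * q ^ 2) M := by
      rw [poch_succ']; ring_nf
    rw [W, f]
    simp only [poch_zero, Nat.sub_zero, mul_zero, zero_add, pow_one, pow_zero, mul_one, one_mul]
    clear f this hA
    generalize poch q (c1 * c2 * q ^ 2) M = V1 at *
    generalize poch q (q * c3) M = V2 at *
    generalize poch q q M = V3 at *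
    generalize (q * c2) ^ M = V4 at *
    generalize 1 - c2 * c1 * q = V5 at *
    field_simp
  · intro x hx hx0
    have := orth g.symm x 0 (by have := Finset.mem_range.1 hx; omega) (by omega) hx0
    rw [← mul_zero (W q c3 c2 c1 M x * RC q c1 c2 c3 M (q ^ n) (q ^ x)), ← this, Finset.mul_sum]
    apply Finset.sum_congr rfl
    intro m _
    rw [RC_symm q c1 c2 c3 M (q ^ m), pow_zero, RC_symm q c3 c2 c1 M 1, RC_one q _ _ _ hq]
    ring
  · simp

end qR

namespace qR

lemma poch_rev (q : ℂ) (hq : q ≠ 0) (j : ℕ) : ∀ u v : ℂ, u * v * q ^ j = q →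
    poch q u j = (-1) ^ j * u ^ j * q ^ ((j : ℤ) * ((j : ℤ) - 1) / 2) * poch q v j := by
  induction j with
  | zero => intro u v _; simp [poch_zero]
  | succ j ih =>
    intro u v h
    have h' : u * v * q ^ j = 1 := by
      apply mul_right_cancel₀ hq
      rw [one_mul]; rw [pow_succ] at h; linear_combination h
    have hi := ih u (v * q) (by linear_combination q * h')
    rw [poch_succ, poch_succ', hi]
    have e : (((j+1 : ℕ) : ℤ) * (((j+1 : ℕ) : ℤ) - 1) / 2) = (j : ℤ) * ((j : ℤ) - 1) / 2 + j := by
      rw [show (((j+1 : ℕ) : ℤ) * (((j+1 : ℕ) : ℤ) - 1)) = (j : ℤ) * ((j : ℤ) - 1) + j * 2 by push_cast; ring]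
      rw [Int.add_mul_ediv_right _ _ (by norm_num)]
    rw [e, zpow_add₀ hq, zpow_natCast]
    have : 1 - u * q ^ j = - u * q ^ j * (1 - v) := by linear_combination (-1 : ℂ) * h'
    rw [this]
    ring

lemma Om_eq (q s c1 c2 c3 t2 : ℂ) (hq : q ≠ 0) (hs : s ^ 2 = q) (ht : t2 ^ 2 = c2) (h2 : c2 ≠ 0) (M n : ℕ) (hn : n ≤ M) :
    Om q s c1 c2 c3 t2 (M : ℤ) (n : ℤ) = (s * t2) ^ M * W q c1 c2 c3 M n := by
  have hst : s * t2 ≠ 0 := by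
    intro h
    have : q * c2 = 0 := by rw [← hs, ← ht, ← mul_pow, h]; ring
    exact mul_ne_zero hq h2 this
  have e1 : (s * t2) ^ (2 * (n : ℤ) - (M : ℤ)) = (q * c2) ^ n / (s * t2) ^ M := by
    rw [zpow_sub₀ hst, zpow_natCast, zpow_mul]
    congr 1
    rw [zpow_natCast]
    congr 1
    rw [← hs, ← ht, ← mul_pow]
    norm_cast
  have hpos : (0 : ℤ) ≤ n ∧ (n : ℤ) ≤ M := ⟨by positivity, by exact_mod_cast hn⟩
  rw [Om, binom, if_pos hpos, e1]
  have e2 : ((M : ℤ) - (n : ℤ)).toNat = M - n := by omega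
  have e3 : ((M : ℤ) + 1).toNat = M + 1 := by omega
  have e4 : q ^ (2 * (n : ℤ) + 1) = q ^ (2 * n + 1) := by norm_cast
  have e5 : q ^ ((M : ℤ) + 2) = q ^ (M + 2) := by norm_cast
  have e6 : q ^ ((n : ℤ) + 1) = q ^ (n + 1) := by norm_cast
  rw [e2, e3, e4, e5, e6, Int.toNat_natCast, Int.toNat_natCast, W]
  have : (s * t2) ^ M ≠ 0 := pow_ne_zero _ hst
  generalize (s * t2) ^ M = S at *
  rw [show ∀ a b c : ℂ, a / S * b * c = (a * b * c) / S by intros; ring, div_div_eq_mul_div]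
  ring

lemma Om_big (q s c1 c2 c3 t2 : ℂ) (M n : ℕ) (hn : M < n) :
    Om q s c1 c2 c3 t2 (M : ℤ) (n : ℤ) = 0 := by
  rw [Om, binom, if_neg (by omega)]; simp

lemma p_eq (q s c1 c2 c3 t2 : ℂ) (hq : q ≠ 0) (M n x : ℕ) (hn : n ≤ M) (hx : x ≤ M) :
    p q s c1 c2 c3 t2 (M : ℤ) (n : ℤ) (x : ℤ) = Om q s c1 c2 c3 t2 (M : ℤ) (n : ℤ) *
      RC q c1 c2 c3 M (q ^ n) (q ^ x) := by
  rw [p, if_pos (by omega), Int.toNat_natCast, RC]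
  congr 1
  have hsub : Finset.range (n+1) ⊆ Finset.range (M+1) := by
    intro a; simp only [Finset.mem_range]; omega
  rw [← Finset.sum_subset hsub]
  · apply Finset.sum_congr rfl
    intro k _
    have e5 : q ^ ((M : ℤ) + 2) = q ^ (M + 2) := by norm_cast
    have e6 : ∀ n : ℕ, q ^ ((n : ℤ) + 1) = q ^ (n + 1) := by intro n; norm_cast
    rw [dn, ph, ph, e5, e6, e6]
    simp only [zpow_neg, zpow_natCast]
    rw [show c2 * c3 * q * q ^ n = c2 * c3 * q ^ (n+1) by ring, show c1 * c2 * q * q ^ x = c1 * c2 * q ^ (x+1) by ring]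
    ring
  · intro k _ hk
    simp only [Finset.mem_range] at hk
    rw [ph, poch_eq_zero q hq n k (by omega)]; simp

lemma p_big (q s c1 c2 c3 t2 : ℂ) (M n x : ℕ) (h : M < n ∨ M < x) :
    p q s c1 c2 c3 t2 (M : ℤ) (n : ℤ) (x : ℤ) = 0 := by
  rw [p, if_neg (by omega)]

lemma orthP {q s c1 c2 c3 t2 : ℂ} {M : ℕ} (g : Gen q c1 c2 c3 M) (hs : s ^ 2 = q) (ht : t2 ^ 2 = c2) (n m : ℕ) :
    ∑ x ∈ Finset.range (M+1), Om q s c3 c2 c1 t2 (M : ℤ) (x : ℤ) * p q s c1 c2 c3 t2 (M : ℤ) (n : ℤ) (x : ℤ)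
      * p q s c1 c2 c3 t2 (M : ℤ) (m : ℤ) (x : ℤ) =
     if n = m then Om q s c1 c2 c3 t2 (M : ℤ) (n : ℤ) else 0 := by
  have hq := g.hq
  by_cases hn : M < n
  · rw [Om_big _ _ _ _ _ _ _ _ hn, Finset.sum_eq_zero]
    · simp
    · intro x _; rw [p_big _ _ _ _ _ _ _ n x (Or.inl hn)]; ring
  by_cases hm : M < m
  · rw [if_neg (by omega), Finset.sum_eq_zero]
    intro x _; rw [p_big _ _ _ _ _ _ _ m x (Or.inl hm)]; ring
  push Not at hn hm
  have e : ∀ x ∈ Finset.range (M+1), Om q s c3 c2 c1 t2 (M : ℤ) (x : ℤ) * p q s c1 c2 c3 t2 (M : ℤ) (n : ℤ) (x : ℤ)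
      * p q s c1 c2 c3 t2 (M : ℤ) (m : ℤ) (x : ℤ) = (s * t2) ^ M * Om q s c1 c2 c3 t2 (M : ℤ) (n : ℤ) * Om q s c1 c2 c3 t2 (M : ℤ) (m : ℤ)
       * (W q c3 c2 c1 M x * RC q c1 c2 c3 M (q ^ n) (q ^ x) * RC q c1 c2 c3 M (q ^ m) (q ^ x)) := by
    intro x hx
    have hx : x ≤ M := by have := Finset.mem_range.1 hx; omega
    rw [p_eq _ _ _ _ _ _ hq M n x hn hx, p_eq _ _ _ _ _ _ hq M m x hm hx,
      Om_eq q s c3 c2 c1 t2 hq hs ht g.h2 M x hx]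
    ring
  rw [Finset.sum_congr rfl e, ← Finset.mul_sum]
  by_cases hnm : n = m
  · subst hnm
    rw [if_pos rfl]
    have := norm_W g n hn
    have hO := Om_eq q s c1 c2 c3 t2 hq hs ht g.h2 M n hn
    have h0 : (q * c2) ^ M ≠ 0 := pow_ne_zero _ (mul_ne_zero hq g.h2)
    have hS : (s * t2) ^ M * (s * t2) ^ M = (q * c2) ^ M := by
      rw [← mul_pow]; congr 1; rw [← hs, ← ht]; ring
    generalize ∑ x ∈ Finset.range (M+1), W q c3 c2 c1 M x * RC q c1 c2 c3 M (q ^ n) (q ^ x)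
      * RC q c1 c2 c3 M (q ^ n) (q ^ x) = Sg at *
    have h1 : (q * c2) ^ M * (W q c1 c2 c3 M n * Sg) = 1 := by rw [this]; field_simp
    rw [← hS] at h1
    calc _ = Om q s c1 c2 c3 t2 (M : ℤ) (n : ℤ) * ((s * t2) ^ M * Om q s c1 c2 c3 t2 (M : ℤ) (n : ℤ) * Sg) := by ring
      _ = _ := by
        rw [hO]
        linear_combination (s * t2) ^ M * W q c1 c2 c3 M n * h1
  · rw [if_neg hnm, orth g n m hn hm hnm, mul_zero]

lemma Lam_eq (q s c1 c2 c3 c4 t1 t2 t3 t4 : ℂ) (N x : ℕ) (hx : x ≤ N) :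
    Lam q s c1 c2 c3 c4 t1 t2 t3 t4 (N : ℤ) (x : ℤ) =
    (-1) ^ x * (poch q q N / (poch q q x * poch q q (N - x))) * (1 - c1 * c2 * q ^ (2 * x + 1)) * poch q (q * c2) x
      * (s * t2) ^ N * (t1 * t3 / (t2 * t4)) ^ x * q ^ ((x : ℤ) * ((x : ℤ) - 1) / 2)
    / (poch q (q * c1) x * poch q (c1 * c2 * q ^ (x + 1)) (N + 1)) := by
  have e2 : ((N : ℤ) - (x : ℤ)).toNat = N - x := by omega
  have e3 : ((N : ℤ) + 1).toNat = N + 1 := by omega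
  have e4 : q ^ (2 * (x : ℤ) + 1) = q ^ (2 * x + 1) := by norm_cast
  have e6 : q ^ ((x : ℤ) + 1) = q ^ (x + 1) := by norm_cast
  rw [Lam, binom, if_pos (by omega), e2, e3, e4, e6]
  simp only [Int.toNat_natCast, zpow_natCast]
  rw [show q ^ (x+1) * c1 * c2 = c1 * c2 * q ^ (x+1) by ring]

set_option maxHeartbeats 1000000 in
lemma cross (q s c1 c2 c3 c4 c0 t1 t2 t3 t4 t0 : ℂ) (x j r : ℕ)
    (hs0 : s ≠ 0) (n1 : t1 ≠ 0) (n2 : t2 ≠ 0) (n3 : t3 ≠ 0) (n4 : t4 ≠ 0) (n0 : t0 ≠ 0)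
    (hs : s ^ 2 = q) (ht1 : t1 ^ 2 = c1) (ht2 : t2 ^ 2 = c2) (ht3 : t3 ^ 2 = c3)
    (ht4 : t4 ^ 2 = c4) (ht0 : t0 ^ 2 = c0)
    (hT : t0 * t1 * t2 * t3 * t4 * s ^ (2 * (x + j + r) + 3) = 1)
    (h1 : poch q (c1 * c2 * q ^ (2 * x + r + 2)) j ≠ 0)
    (h2 : poch q (c0 * c4 * q ^ (2 * j + r + 2)) x ≠ 0)
    (hP1 : poch q q (j + r) ≠ 0) (hP2 : poch q q (x + r) ≠ 0) :
    Lam q s c1 c2 c3 c4 t1 t2 t3 t4 ((x + j + r : ℕ) : ℤ) (x : ℤ) * Om q s c3 c0 c4 t0 ((j + r : ℕ) : ℤ) (j : ℤ) =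
    Om q s c3 c2 c1 t2 ((x + r : ℕ) : ℤ) (x : ℤ) * Lam q s c4 c0 c3 c1 t4 t0 t3 t1 ((x + j + r : ℕ) : ℤ) (j : ℤ) := by
  have hq : q ≠ 0 := by rw [← hs]; exact pow_ne_zero _ hs0
  have hc2 : c2 ≠ 0 := by rw [← ht2]; exact pow_ne_zero _ n2
  have hc0 : c0 ≠ 0 := by rw [← ht0]; exact pow_ne_zero _ n0
  have hC : c0 * c1 * c2 * c3 * c4 * q ^ (2 * (x + j + r) + 3) = 1 := by
    rw [← hs, ← ht1, ← ht2, ← ht3, ← ht4, ← ht0]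
    calc _ = (t0 * t1 * t2 * t3 * t4 * s ^ (2 * (x + j + r) + 3)) ^ 2 := by ring
      _ = 1 := by rw [hT]; ring
  rw [Lam_eq _ _ _ _ _ _ _ _ _ _ _ _ (by omega), Lam_eq _ _ _ _ _ _ _ _ _ _ _ _ (by omega),
    Om_eq _ _ _ _ _ _ hq hs ht0 hc0 _ _ (by omega), Om_eq _ _ _ _ _ _ hq hs ht2 hc2 _ _ (by omega), W, W,
    show x + j + r - x = j + r by omega, show x + j + r - j = x + r by omega,
    show j + r - j = r by omega, show x + r - x = r by omega]
  rw [poch_rev q hq j (c3 * c0 * c4 * q ^ (j + r + 2)) (c1 * c2 * q ^ (2 * x + r + 2))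
    (by linear_combination q * hC)]
  rw [poch_rev q hq x (c3 * c2 * c1 * q ^ (x + r + 2)) (c0 * c4 * q ^ (2 * j + r + 2))
    (by linear_combination q * hC)]
  have f1 : poch q (c1 * c2 * q ^ (x+1)) (x + j + r + 1) = poch q (c1 * c2 * q ^ (x+1)) (x + r + 1) *
     poch q (c1 * c2 * q ^ (2 * x + r + 2)) j := by
    rw [show x + j + r + 1 = x + r + 1 + j by ring, poch_add]; ring_nf
  have f2 : poch q (c4 * c0 * q ^ (j+1)) (x + j + r + 1) = poch q (c0 * c4 * q ^ (j+1)) (j + r + 1) *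
     poch q (c0 * c4 * q ^ (2 * j + r + 2)) x := by
    rw [show x + j + r + 1 = j + r + 1 + x by ring, poch_add]; ring_nf
  rw [f1, f2, mul_comm c4 c0, mul_comm c2 c1]
  have sc : (s * t2) ^ j * (t1 * t3 / (t2 * t4)) ^ x * (c3 * c0 * c4 * q ^ (j + r + 2)) ^ j * (q * c2) ^ x
     = (c3 * c2 * c1 * q ^ (x + r + 2)) ^ x * (s * t0) ^ x * (t4 * t3 / (t0 * t1)) ^ j * (q * c0) ^ j := by
    have u1 : (t4 * t3 / (t0 * t1)) * (q * c0) = (s * t2) * (c3 * c0 * c4 * q ^ (j + r + 2)) * q ^ x := by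
      rw [← hs, ← ht0, ← ht3, ← ht4]
      field_simp
      linear_combination (-s) * hT
    have u2 : (t1 * t3 / (t2 * t4)) * (q * c2) = (c3 * c2 * c1 * q ^ (x + r + 2)) * (s * t0) * q ^ j := by
      rw [← hs, ← ht1, ← ht3, ← ht2]
      field_simp
      linear_combination (-s) * hT
    calc _ = ((s * t2) * (c3 * c0 * c4 * q ^ (j + r + 2))) ^ j * ((t1 * t3 / (t2 * t4)) * (q * c2)) ^ x := by
          simp only [mul_pow]; ring
      _ = ((c3 * c2 * c1 * q ^ (x + r + 2)) * (s * t0)) ^ x * ((s * t2) * (c3 * c0 * c4 * q ^ (j + r + 2)) * q ^ x) ^ j := by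
          rw [u2, mul_pow _ (q ^ j), mul_pow _ (q ^ x), ← pow_mul, ← pow_mul, mul_comm j x]; ring
      _ = _ := by
          rw [← u1]; simp only [mul_pow]; ring
  rw [show (s * t2) ^ (x + j + r) = (s * t2) ^ (x + r) * (s * t2) ^ j by ring,
    show (s * t0) ^ (x + j + r) = (s * t0) ^ (j + r) * (s * t0) ^ x by ring]
  have k1 : (q * c2) ^ x ≠ 0 := pow_ne_zero _ (mul_ne_zero hq hc2)
  have k2 : (q * c0) ^ j ≠ 0 := pow_ne_zero _ (mul_ne_zero hq hc0)
  clear f1 f2 hC hT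
  generalize (c3 * c2 * c1 * q ^ (x + r + 2)) ^ x = B1 at *
  generalize (c3 * c0 * c4 * q ^ (j + r + 2)) ^ j = B2 at *
  generalize (s * t2) ^ j = B3 at *
  generalize (s * t0) ^ x = B4 at *
  generalize (t4 * t3 / (t0 * t1)) ^ j = B5 at *
  generalize (t1 * t3 / (t2 * t4)) ^ x = B6 at *
  generalize (q * c2) ^ x = B7 at *
  generalize (q * c0) ^ j = B8 at *
  generalize poch q (c1 * c2 * q ^ (2 * x + r + 2)) j = A1 at *
  generalize poch q (c0 * c4 * q ^ (2 * j + r + 2)) x = A2 at *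
  generalize poch q q (j + r) = A3 at *
  generalize poch q q (x + r) = A4 at *
  generalize poch q (c1 * c2 * q ^ (x+1)) (x + r + 1) = A5 at *
  generalize poch q (c0 * c4 * q ^ (j+1)) (j + r + 1) = A6 at *
  generalize poch q q (x + j + r) = A7 at *
  generalize poch q q x = A8
  generalize poch q q j = A9
  generalize poch q q r = A10
  generalize poch q (q * c2) x = D1
  generalize poch q (q * c1) x = D2
  generalize poch q (q * c0) j = D3
  generalize poch q (q * c4) j = D4
  generalize poch q (q * c3) r = D5
  generalize q ^ ((x : ℤ) * ((x : ℤ) - 1) / 2) = E1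
  generalize q ^ ((j : ℤ) * ((j : ℤ) - 1) / 2) = E2
  generalize 1 - c1 * c2 * q ^ (2 * x + 1) = D6
  generalize 1 - c0 * c4 * q ^ (2 * j + 1) = D7
  generalize (s * t2) ^ (x + r) = D8
  generalize (s * t0) ^ (j + r) = D9
  generalize (-1 : ℂ) ^ x = F1
  generalize (-1 : ℂ) ^ j = F2
  have key : B3 * B6 * B2 / B8 = B1 * B4 * B5 / B7 := by
    rw [div_eq_div_iff k2 k1]; exact sc
  have l1 : A1 * A1⁻¹ = 1 := mul_inv_cancel₀ h1
  have l2 : A2 * A2⁻¹ = 1 := mul_inv_cancel₀ h2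
  have l3 : A3 * A3⁻¹ = 1 := mul_inv_cancel₀ hP1
  have l4 : A4 * A4⁻¹ = 1 := mul_inv_cancel₀ hP2
  trans (F1 * F2 * A7 * A8⁻¹ * A9⁻¹ * A10⁻¹ * D1 * D2⁻¹ * D3 * D4⁻¹ * D5 * D6 * D7 * D8 * D9 * E1 * E2 * A5⁻¹ * A6⁻¹) * (B3 * B6 * B2 / B8)
  · trans (F1 * F2 * A7 * A8⁻¹ * A9⁻¹ * A10⁻¹ * D1 * D2⁻¹ * D3 * D4⁻¹ * D5 * D6 * D7 * D8 * D9 * E1 * E2 * A5⁻¹ * A6⁻¹) * (B3 * B6 * B2 / B8) * (A1 * A1⁻¹) * (A3 * A3⁻¹)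
    · ring
    · rw [l1, l3]; ring
  · rw [key]
    trans (F1 * F2 * A7 * A8⁻¹ * A9⁻¹ * A10⁻¹ * D1 * D2⁻¹ * D3 * D4⁻¹ * D5 * D6 * D7 * D8 * D9 * E1 * E2 * A5⁻¹ * A6⁻¹) * (B1 * B4 * B5 / B7) * (A2 * A2⁻¹) * (A4 * A4⁻¹)
    · rw [l2, l4]; ring
    · ring

end qR

/-- Orthogonality of the Tratnik polynomials of q-Racah type. -/
theorem tratnik_orthogonality
    (N : ℕ) (q s c1 c2 c3 c4 c0 t1 t2 t3 t4 t0 : ℂ)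
    (hq : q ≠ 0) (hc1 : c1 ≠ 0) (hc2 : c2 ≠ 0) (hc3 : c3 ≠ 0) (hc4 : c4 ≠ 0)
    (hs : s ^ 2 = q) (ht1 : t1 ^ 2 = c1) (ht2 : t2 ^ 2 = c2) (ht3 : t3 ^ 2 = c3)
    (ht4 : t4 ^ 2 = c4)
    (hc0 : c0 = (q ^ (2 * (N : ℤ) + 3) * c1 * c2 * c3 * c4)⁻¹)
    (ht0 : t0 = (s ^ (2 * (N : ℤ) + 3) * t1 * t2 * t3 * t4)⁻¹)
    (hgen : ∀ e0 e1 e2 e3 e4 : ℕ, e0 ≤ 1 → e1 ≤ 1 → e2 ≤ 1 → e3 ≤ 1 → e4 ≤ 1 →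
      1 ≤ e0 + e1 + e2 + e3 + e4 → e0 + e1 + e2 + e3 + e4 ≤ 4 →
      ∀ k : ℤ, 1 ≤ k → k ≤ 2 * (N : ℤ) + 5 →
        c0 ^ e0 * c1 ^ e1 * c2 ^ e2 * c3 ^ e3 * c4 ^ e4 ≠ q ^ (-k))
    (hq1 : ∀ k : ℕ, 1 ≤ k → k ≤ N → q ^ k ≠ 1)
    (i j k l : ℕ) (hij : i + j ≤ N) (hkl : k + l ≤ N) :
    ∑ x ∈ Finset.range (N + 1), ∑ y ∈ Finset.range (N + 1 - x),
        qR.Om q s c4 c0 c3 t0 ((N : ℤ) - (x : ℤ)) (y : ℤ)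
          * qR.Lam q s c1 c2 c3 c4 t1 t2 t3 t4 (N : ℤ) (x : ℤ)
          * qR.T q s c1 c2 c3 c4 t1 t2 t3 t4 (N : ℤ) (i : ℤ) (j : ℤ) (x : ℤ) (y : ℤ)
          * qR.T q s c1 c2 c3 c4 t1 t2 t3 t4 (N : ℤ) (k : ℤ) (l : ℤ) (x : ℤ) (y : ℤ)
      = (if i = k ∧ j = l then 1 else 0)
          * qR.Om q s c1 c2 c3 t2 ((N : ℤ) - (j : ℤ)) (i : ℤ)
          * qR.Lam q s c4 c0 c3 c1 t4 t0 t3 t1 (N : ℤ) (j : ℤ) := by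
  have gen : ∀ e0 e1 e2 e3 e4 : ℕ, e0 ≤ 1 → e1 ≤ 1 → e2 ≤ 1 → e3 ≤ 1 → e4 ≤ 1 →
      1 ≤ e0 + e1 + e2 + e3 + e4 → e0 + e1 + e2 + e3 + e4 ≤ 4 →
      ∀ k : ℕ, 1 ≤ k → k ≤ 2 * N + 5 →
        c0 ^ e0 * c1 ^ e1 * c2 ^ e2 * c3 ^ e3 * c4 ^ e4 * q ^ k ≠ 1 := by
    intro e0 e1 e2 e3 e4 a0 a1 a2 a3 a4 b b' k hk hk' h
    apply hgen e0 e1 e2 e3 e4 a0 a1 a2 a3 a4 b b' (k : ℤ) (by omega) (by omega)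
    rw [zpow_neg, zpow_natCast]
    exact eq_inv_of_mul_eq_one_left h
  have m1 : ∀ k : ℕ, 1 ≤ k → k ≤ 2 * N + 5 → c1 * q ^ k ≠ 1 := by
    simpa using gen 0 1 0 0 0 (by simp) (by simp) (by simp) (by simp) (by simp) (by simp) (by simp)
  have m2 : ∀ k : ℕ, 1 ≤ k → k ≤ 2 * N + 5 → c2 * q ^ k ≠ 1 := by
    simpa using gen 0 0 1 0 0 (by simp) (by simp) (by simp) (by simp) (by simp) (by simp) (by simp)
  have m3 : ∀ k : ℕ, 1 ≤ k → k ≤ 2 * N + 5 → c3 * q ^ k ≠ 1 := by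
    simpa using gen 0 0 0 1 0 (by simp) (by simp) (by simp) (by simp) (by simp) (by simp) (by simp)
  have m4 : ∀ k : ℕ, 1 ≤ k → k ≤ 2 * N + 5 → c4 * q ^ k ≠ 1 := by
    simpa using gen 0 0 0 0 1 (by simp) (by simp) (by simp) (by simp) (by simp) (by simp) (by simp)
  have m0 : ∀ k : ℕ, 1 ≤ k → k ≤ 2 * N + 5 → c0 * q ^ k ≠ 1 := by
    simpa using gen 1 0 0 0 0 (by simp) (by simp) (by simp) (by simp) (by simp) (by simp) (by simp)
  have m12 : ∀ k : ℕ, 1 ≤ k → k ≤ 2 * N + 5 → c1 * c2 * q ^ k ≠ 1 := by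
    simpa using gen 0 1 1 0 0 (by simp) (by simp) (by simp) (by simp) (by simp) (by simp) (by simp)
  have m23 : ∀ k : ℕ, 1 ≤ k → k ≤ 2 * N + 5 → c2 * c3 * q ^ k ≠ 1 := by
    simpa using gen 0 0 1 1 0 (by simp) (by simp) (by simp) (by simp) (by simp) (by simp) (by simp)
  have m03 : ∀ k : ℕ, 1 ≤ k → k ≤ 2 * N + 5 → c0 * c3 * q ^ k ≠ 1 := by
    simpa using gen 1 0 0 1 0 (by simp) (by simp) (by simp) (by simp) (by simp) (by simp) (by simp)
  have m04 : ∀ k : ℕ, 1 ≤ k → k ≤ 2 * N + 5 → c0 * c4 * q ^ k ≠ 1 := by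
    simpa using gen 1 0 0 0 1 (by simp) (by simp) (by simp) (by simp) (by simp) (by simp) (by simp)
  have m123 : ∀ k : ℕ, 1 ≤ k → k ≤ 2 * N + 5 → c1 * c2 * c3 * q ^ k ≠ 1 := by
    simpa using gen 0 1 1 1 0 (by simp) (by simp) (by simp) (by simp) (by simp) (by simp) (by simp)
  have m034 : ∀ k : ℕ, 1 ≤ k → k ≤ 2 * N + 5 → c0 * c3 * c4 * q ^ k ≠ 1 := by
    simpa using gen 1 0 0 1 1 (by simp) (by simp) (by simp) (by simp) (by simp) (by simp) (by simp)
  have hs0 : s ≠ 0 := by rintro rfl; apply hq; rw [← hs]; simp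
  have n1 : t1 ≠ 0 := by rintro rfl; apply hc1; rw [← ht1]; simp
  have n2 : t2 ≠ 0 := by rintro rfl; apply hc2; rw [← ht2]; simp
  have n3 : t3 ≠ 0 := by rintro rfl; apply hc3; rw [← ht3]; simp
  have n4 : t4 ≠ 0 := by rintro rfl; apply hc4; rw [← ht4]; simp
  have hz : ∀ a : ℂ, a ^ (2 * (N : ℤ) + 3) = a ^ (2 * N + 3) := by
    intro a; rw [← zpow_natCast]; norm_cast
  have hT : t0 * t1 * t2 * t3 * t4 * s ^ (2 * N + 3) = 1 := by
    rw [ht0, hz]; field_simp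
  have n0 : t0 ≠ 0 := by rintro rfl; simp at hT
  have ht0' : t0 ^ 2 = c0 := by
    rw [ht0, hc0, hz, hz, inv_pow, ← hs, ← ht1, ← ht2, ← ht3, ← ht4]; ring
  have hc00 : c0 ≠ 0 := by rw [← ht0']; exact pow_ne_zero _ n0
  have G1 : qR.Gen q c1 c2 c3 (N - j) :=
    { hq := hq, h1 := hc1, h2 := hc2, h3 := hc3
      gq := fun k a b => hq1 k a (by omega)
      g1 := fun k a b => m1 k a (by omega)
      g2 := fun k a b => m2 k a (by omega)
      g3 := fun k a b => m3 k a (by omega)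
      g12 := fun k a b => m12 k a (by omega)
      g23 := fun k a b => m23 k a (by omega)
      g123 := fun k a b => m123 k (by omega) (by omega) }
  have G0 : ∀ x : ℕ, qR.Gen q c3 c0 c4 (N - x) := fun x =>
    { hq := hq, h1 := hc3, h2 := hc00, h3 := hc4
      gq := fun k a b => hq1 k a (by omega)
      g1 := fun k a b => m3 k a (by omega)
      g2 := fun k a b => m0 k a (by omega)
      g3 := fun k a b => m4 k a (by omega)
      g12 := fun k a b => by rw [mul_comm c3]; exact m03 k a (by omega)
      g23 := fun k a b => m04 k a (by omega)
      g123 := fun k a b => by rw [mul_comm c3]; exact m034 k (by omega) (by omega) }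
  have cN : ∀ x : ℕ, x ≤ N → (N : ℤ) - (x : ℤ) = ((N - x : ℕ) : ℤ) := fun x hx => by omega
  have hTij : ∀ i j x y : ℕ, i + j ≤ N → qR.T q s c1 c2 c3 c4 t1 t2 t3 t4 (N : ℤ) (i : ℤ) (j : ℤ) (x : ℤ) (y : ℤ)
      = qR.p q s c1 c2 c3 t2 ((N : ℤ) - j) i x * qR.p q s c3 c0 c4 t0 ((N : ℤ) - x) j y := by
    intro i j x y h
    unfold qR.T
    rw [if_pos (by omega), ← hc0, ← ht0]
  have inner : ∀ x ∈ Finset.range (N + 1), ∑ y ∈ Finset.range (N + 1 - x),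
        qR.Om q s c4 c0 c3 t0 ((N : ℤ) - (x : ℤ)) (y : ℤ)
          * qR.Lam q s c1 c2 c3 c4 t1 t2 t3 t4 (N : ℤ) (x : ℤ)
          * qR.T q s c1 c2 c3 c4 t1 t2 t3 t4 (N : ℤ) (i : ℤ) (j : ℤ) (x : ℤ) (y : ℤ)
          * qR.T q s c1 c2 c3 c4 t1 t2 t3 t4 (N : ℤ) (k : ℤ) (l : ℤ) (x : ℤ) (y : ℤ)
      = qR.Lam q s c1 c2 c3 c4 t1 t2 t3 t4 (N : ℤ) (x : ℤ)
        * (qR.p q s c1 c2 c3 t2 ((N - j : ℕ) : ℤ) i x * qR.p q s c1 c2 c3 t2 ((N - l : ℕ) : ℤ) k x)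
        * (if j = l then qR.Om q s c3 c0 c4 t0 ((N - x : ℕ) : ℤ) j else 0) := by
    intro x hx
    have hx' : x ≤ N := by simpa [Nat.lt_succ_iff] using hx
    rw [← qR.orthP (G0 x) hs ht0' j l, Finset.mul_sum, show N + 1 - x = N - x + 1 by omega]
    refine Finset.sum_congr rfl fun y _ => ?_
    rw [hTij i j x y hij, hTij k l x y hkl, cN x hx', cN j (by omega), cN l (by omega)]
    ring
  rw [Finset.sum_congr rfl inner]
  by_cases hjl : j = l
  swap
  · simp [hjl]
  subst hjl
  have hsub : Finset.range (N - j + 1) ⊆ Finset.range (N + 1) := by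
    intro a; simp only [Finset.mem_range]; omega
  rw [← Finset.sum_subset hsub]
  swap
  · intro x _ hx
    rw [qR.p_big q s c1 c2 c3 t2 (N - j) i x (Or.inr (by simp only [Finset.mem_range] at hx; omega))]
    ring
  have key : ∀ x ∈ Finset.range (N - j + 1), qR.Lam q s c1 c2 c3 c4 t1 t2 t3 t4 (N : ℤ) (x : ℤ)
        * (qR.p q s c1 c2 c3 t2 ((N - j : ℕ) : ℤ) i x * qR.p q s c1 c2 c3 t2 ((N - j : ℕ) : ℤ) k x)
        * (if j = j then qR.Om q s c3 c0 c4 t0 ((N - x : ℕ) : ℤ) j else 0)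
      = qR.Lam q s c4 c0 c3 c1 t4 t0 t3 t1 (N : ℤ) (j : ℤ) *
        (qR.Om q s c3 c2 c1 t2 ((N - j : ℕ) : ℤ) x * qR.p q s c1 c2 c3 t2 ((N - j : ℕ) : ℤ) i x
          * qR.p q s c1 c2 c3 t2 ((N - j : ℕ) : ℤ) k x) := by
    intro x hx
    rw [Finset.mem_range] at hx
    obtain ⟨r, hr⟩ : ∃ r, N = x + j + r := ⟨N - j - x, by omega⟩
    have e1 : N - x = j + r := by omega
    have e2 : N - j = x + r := by omega
    have hP : ∀ n, n ≤ N → qR.poch q q n ≠ 0 := fun n hn => qR.poch_ne _ _ _ fun l hl => by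
      rw [← pow_succ']; exact hq1 _ (by omega) (by omega)
    have c := qR.cross q s c1 c2 c3 c4 c0 t1 t2 t3 t4 t0 x j r hs0 n1 n2 n3 n4 n0 hs ht1 ht2 ht3 ht4 ht0'
      (by rw [← hr]; exact hT)
      (qR.poch_ne _ _ _ fun l hl => by rw [mul_assoc, ← pow_add]; exact m12 _ (by omega) (by omega))
      (qR.poch_ne _ _ _ fun l hl => by rw [mul_assoc, ← pow_add]; exact m04 _ (by omega) (by omega))
      (hP _ (by omega)) (hP _ (by omega))
    rw [← hr, ← e1, ← e2] at c
    rw [if_pos rfl]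
    linear_combination (qR.p q s c1 c2 c3 t2 ((N - j : ℕ) : ℤ) i x * qR.p q s c1 c2 c3 t2 ((N - j : ℕ) : ℤ) k x) * c
  rw [Finset.sum_congr rfl key, ← Finset.mul_sum, qR.orthP G1 hs ht2 i k, cN j (by omega)]
  by_cases hik : i = k
  · simp [hik]; ring
  · simp [hik]
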